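/- For every constant C > 0 there exists a constant K = K(C) > 0 such that for all n ≥ 1 the probability that the random symmetric Bernoulli matrix M_n is singular satisfies P(det(M_n) = 0) ≤ K · n^{−C}. -/

import Mathlib

open scoped Classical BigOperators

noncomputable section

/-- The real number (±1) corresponding to a Boolean sign bit. -/
def signv (b : Bool) : ℝ := if b then 1 else -1

/-- The random symmetric Bernoulli (±1) matrix: the entries on and above the diagonal are
given by independent sign bits `g i j` (for `i ≤ j`), and the below-diagonal entries are
determined by symmetry. -/
def symMat (n : ℕ) (g : Fin n → Fin n → Bool) : Matrix (Fin n) (Fin n) ℝ :=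
  Matrix.of fun i j => if i ≤ j then signv (g i j) else signv (g j i)

/-- Probability of an event for the random symmetric Bernoulli matrix, with respect to the
uniform distribution on the sign bits. -/
def probSym (n : ℕ) (p : Matrix (Fin n) (Fin n) ℝ → Prop) : ℝ :=
  ((Finset.univ.filter fun g : Fin n → Fin n → Bool => p (symMat n g)).card : ℝ) /
    (Fintype.card (Fin n → Fin n → Bool) : ℝ)

/-! ### The cosine character of `ZMod p` -/

section Fourier

variable {p : ℕ} [Fact p.Prime]

/-- The real part of the standard additive character of `ZMod p`, that is `cos (2 π x / p)`. -/
def cosChar (x : ZMod p) : ℝ := (ZMod.stdAddChar x : ℂ).re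

lemma stdAddChar_normSq (x : ZMod p) :
    (ZMod.stdAddChar x : ℂ).re ^ 2 + (ZMod.stdAddChar x : ℂ).im ^ 2 = 1 := by
  have h : ‖(ZMod.stdAddChar x : ℂ)‖ = 1 := by
    rw [ZMod.stdAddChar_apply]; exact Circle.norm_coe _
  have h2 := Complex.sq_norm (ZMod.stdAddChar x : ℂ)
  rw [h, Complex.normSq_apply] at h2
  linarith

lemma stdAddChar_neg_re (x : ZMod p) :
    (ZMod.stdAddChar (-x) : ℂ).re = (ZMod.stdAddChar x : ℂ).re ∧
    (ZMod.stdAddChar (-x) : ℂ).im = -(ZMod.stdAddChar x : ℂ).im := by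
  have h : (ZMod.stdAddChar (-x) : ℂ) = (starRingEnd ℂ) (ZMod.stdAddChar x) := by
    rw [ZMod.stdAddChar_apply, ZMod.stdAddChar_apply, AddChar.map_neg_eq_inv,
      Circle.coe_inv_eq_conj]
  rw [h]
  exact ⟨Complex.conj_re _, Complex.conj_im _⟩

@[simp] lemma cosChar_zero : cosChar (0 : ZMod p) = 1 := by
  simp [cosChar]

lemma cosChar_neg (x : ZMod p) : cosChar (-x) = cosChar x := (stdAddChar_neg_re x).1

lemma cosChar_add_add_cosChar_sub (x y : ZMod p) :
    cosChar (x + y) + cosChar (x - y) = 2 * cosChar x * cosChar y := by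
  have h := stdAddChar_neg_re y
  simp only [cosChar, sub_eq_add_neg, AddChar.map_add_eq_mul, Complex.mul_re, h.1, h.2]
  ring

lemma cosChar_sq_le_one (x : ZMod p) : cosChar x ^ 2 ≤ 1 := by
  have h := stdAddChar_normSq x
  have h2 := sq_nonneg (ZMod.stdAddChar x : ℂ).im
  unfold cosChar
  linarith

lemma cosChar_two_mul (x : ZMod p) : cosChar (2 * x) = 2 * cosChar x ^ 2 - 1 := by
  have h := cosChar_add_add_cosChar_sub x x
  rw [sub_self, cosChar_zero, ← two_mul] at h
  linarith

lemma one_sub_cosChar_add_le (x y : ZMod p) :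
    1 - cosChar (x + y) ≤ 2 * (1 - cosChar x) + 2 * (1 - cosChar y) := by
  have hx := stdAddChar_normSq x
  have hy := stdAddChar_normSq y
  simp only [cosChar, AddChar.map_add_eq_mul, Complex.mul_re]
  set a := (ZMod.stdAddChar x : ℂ).re
  set b := (ZMod.stdAddChar x : ℂ).im
  set c := (ZMod.stdAddChar y : ℂ).re
  set d := (ZMod.stdAddChar y : ℂ).im
  nlinarith [sq_nonneg (a + c - 2), sq_nonneg (d - b)]

lemma expect_stdAddChar (a : ZMod p) :
    𝔼 t : ZMod p, (ZMod.stdAddChar (t * a) : ℂ) = if a = 0 then 1 else 0 := by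
  have hp : (p : ℂ) ≠ 0 := by exact_mod_cast (Fact.out : p.Prime).ne_zero
  rw [Fintype.expect_eq_sum_div_card, AddChar.sum_mulShift a (ZMod.isPrimitive_stdAddChar p),
    ZMod.card]
  split_ifs <;> simp [hp]

lemma expect_cosChar (a : ZMod p) :
    𝔼 t : ZMod p, cosChar (t * a) = if a = 0 then 1 else 0 := by
  have h := congrArg Complex.re (expect_stdAddChar a)
  rw [Fintype.expect_eq_sum_div_card] at h ⊢
  have h2 : (∑ t : ZMod p, (ZMod.stdAddChar (t * a) : ℂ)) / (Fintype.card (ZMod p) : ℂ) =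
      (∑ t : ZMod p, (ZMod.stdAddChar (t * a) : ℂ)) / ((Fintype.card (ZMod p) : ℝ) : ℂ) := by
    norm_cast
  rw [h2, Complex.div_ofReal_re, Complex.re_sum] at h
  unfold cosChar
  rw [h]
  split_ifs <;> simp

lemma two_ne_zero_of_odd (hp : p ≠ 2) : (2 : ZMod p) ≠ 0 := by
  intro h
  have h2 : ((2 : ℕ) : ZMod p) = 0 := by exact_mod_cast h
  rw [ZMod.natCast_eq_zero_iff] at h2
  exact hp ((Nat.prime_dvd_prime_iff_eq Fact.out Nat.prime_two).1 h2)

/-! ### Lazy random walks -/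

variable {ι : Type*}

/-- The Fourier transform of the lazy walk with steps `± 2 w j`, `j ∈ S`. -/
def walkFT (w : ι → ZMod p) (S : Finset ι) (t : ZMod p) : ℝ :=
  ∏ j ∈ S, (1 / 2 + cosChar (t * w j) ^ 2 / 2)

/-- The probability that the lazy walk which, for every `j ∈ S`, moves by `w j` or `- w j`
with probability `1 / 8` each, ends at `a`. -/
def walkProb (w : ι → ZMod p) (S : Finset ι) (a : ZMod p) : ℝ :=
  𝔼 t : ZMod p, walkFT w S t * cosChar (2 * (t * a))

/-- The return probability of the lazy walk. -/
def returnProb (w : ι → ZMod p) (S : Finset ι) : ℝ := 𝔼 t : ZMod p, walkFT w S t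

lemma walkFT_nonneg (w : ι → ZMod p) (S : Finset ι) (t : ZMod p) : 0 ≤ walkFT w S t :=
  Finset.prod_nonneg fun _ _ => by positivity

lemma walkFT_le_one (w : ι → ZMod p) (S : Finset ι) (t : ZMod p) : walkFT w S t ≤ 1 :=
  Finset.prod_le_one (fun _ _ => by positivity) fun j _ => by
    linarith [cosChar_sq_le_one (t * w j)]

lemma walkFT_congr {w w' : ι → ZMod p} {S : Finset ι} (h : ∀ j ∈ S, w j = w' j) :
    walkFT w S = walkFT w' S := by
  funext t
  exact Finset.prod_congr rfl fun j hj => by rw [h j hj]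

lemma walkFT_congr_sign {w w' : ι → ZMod p} {S : Finset ι}
    (h : ∀ j ∈ S, w j = w' j ∨ w j = - w' j) : walkFT w S = walkFT w' S := by
  funext t
  refine Finset.prod_congr rfl fun j hj => ?_
  rcases h j hj with h | h
  · rw [h]
  · rw [h, mul_neg, cosChar_neg]

lemma walkProb_zero (w : ι → ZMod p) (S : Finset ι) : walkProb w S 0 = returnProb w S := by
  simp [walkProb, returnProb]

lemma returnProb_nonneg (w : ι → ZMod p) (S : Finset ι) : 0 ≤ returnProb w S :=
  Finset.expect_nonneg fun _ _ => walkFT_nonneg _ _ _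

lemma walkFT_insert (w : ι → ZMod p) {S : Finset ι} {j : ι} (hj : j ∉ S) (t : ZMod p) :
    walkFT w (insert j S) t = (1 / 2 + cosChar (t * w j) ^ 2 / 2) * walkFT w S t :=
  Finset.prod_insert hj

lemma walkProb_insert (w : ι → ZMod p) {S : Finset ι} {j : ι} (hj : j ∉ S) (a : ZMod p) :
    walkProb w (insert j S) a = 3 / 4 * walkProb w S a +
      (walkProb w S (a + w j) + walkProb w S (a - w j)) / 8 := by
  unfold walkProb
  rw [Finset.mul_expect, ← Finset.expect_add_distrib, Finset.expect_div,
    ← Finset.expect_add_distrib]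
  refine Finset.expect_congr rfl fun t _ => ?_
  have h := cosChar_add_add_cosChar_sub (2 * (t * a)) (2 * (t * w j))
  rw [walkFT_insert w hj, mul_add t, mul_add, mul_sub t, mul_sub]
  rw [← mul_add (walkFT w S t), h, cosChar_two_mul (t * w j)]
  ring

lemma returnProb_insert (w : ι → ZMod p) {S : Finset ι} {j : ι} (hj : j ∉ S) :
    returnProb w (insert j S) = 3 / 4 * returnProb w S + walkProb w S (w j) / 4 := by
  have h : walkProb w S (-w j) = walkProb w S (w j) := by
    unfold walkProb
    refine Finset.expect_congr rfl fun t _ => ?_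
    rw [mul_neg, mul_neg, cosChar_neg]
  rw [← walkProb_zero, walkProb_insert w hj, zero_add, zero_sub, h, walkProb_zero]
  ring

lemma walkProb_empty (hp : p ≠ 2) (w : ι → ZMod p) (a : ZMod p) :
    walkProb w ∅ a = if a = 0 then 1 else 0 := by
  have h := expect_cosChar (2 * a)
  have h2 : (2 * a = 0) ↔ a = 0 := by simp [two_ne_zero_of_odd hp]
  simp only [h2] at h
  rw [← h]
  unfold walkProb
  refine Finset.expect_congr rfl fun t _ => ?_
  simp [walkFT, mul_left_comm]

lemma walkProb_nonneg (hp : p ≠ 2) (w : ι → ZMod p) (S : Finset ι) :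
    ∀ a, 0 ≤ walkProb w S a := by
  induction S using Finset.induction_on with
  | empty =>
    intro a
    rw [walkProb_empty hp]
    split_ifs <;> norm_num
  | insert j S hj ih =>
    intro a
    rw [walkProb_insert w hj]
    have h1 := ih a
    have h2 := ih (a + w j)
    have h3 := ih (a - w j)
    positivity

lemma sum_walkProb (hp : p ≠ 2) (w : ι → ZMod p) (S : Finset ι) :
    ∑ a, walkProb w S a = 1 := by
  induction S using Finset.induction_on with
  | empty => simp [walkProb_empty hp]
  | insert j S hj ih =>
    have h1 : ∑ a, walkProb w S (a + w j) = 1 := by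
      rw [← ih]; exact Equiv.sum_comp (Equiv.addRight (w j)) (walkProb w S)
    have h2 : ∑ a, walkProb w S (a - w j) = 1 := by
      rw [← ih]; exact Equiv.sum_comp (Equiv.subRight (w j)) (walkProb w S)
    simp only [walkProb_insert w hj, Finset.sum_add_distrib, ← Finset.mul_sum,
      ← Finset.sum_div, ih, h1, h2]
    norm_num

lemma returnProb_sub_walkProb_add_le (w : ι → ZMod p) (S : Finset ι) (a b : ZMod p) :
    returnProb w S - walkProb w S (a + b) ≤
      2 * (returnProb w S - walkProb w S a) + 2 * (returnProb w S - walkProb w S b) := by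
  unfold returnProb walkProb
  simp only [← Finset.expect_sub_distrib, Finset.mul_expect, ← Finset.expect_add_distrib]
  refine Finset.expect_le_expect fun t _ => ?_
  have h := one_sub_cosChar_add_le (2 * (t * a)) (2 * (t * b))
  rw [← mul_add, ← mul_add] at h
  nlinarith [mul_le_mul_of_nonneg_left h (walkFT_nonneg w S t)]

lemma returnProb_anti (w : ι → ZMod p) {S T : Finset ι} (h : S ⊆ T) :
    returnProb w T ≤ returnProb w S :=
  Finset.expect_le_expect fun t _ => by
    have h1 : walkFT w T t = walkFT w (T \ S) t * walkFT w S t := (Finset.prod_sdiff h).symm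
    rw [h1]
    exact mul_le_of_le_one_left (walkFT_nonneg _ _ _) (walkFT_le_one _ _ _)

lemma half_returnProb_le_insert (w : ι → ZMod p) {S : Finset ι} (j : ι) :
    returnProb w S / 2 ≤ returnProb w (insert j S) := by
  by_cases hj : j ∈ S
  · rw [Finset.insert_eq_of_mem hj]
    linarith [returnProb_nonneg w S]
  · unfold returnProb
    rw [Finset.expect_div]
    refine Finset.expect_le_expect fun t _ => ?_
    rw [walkFT_insert w hj]
    nlinarith [walkFT_nonneg w S t, mul_nonneg (sq_nonneg (cosChar (t * w j))) (walkFT_nonneg w S t)]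

lemma returnProb_empty (w : ι → ZMod p) : returnProb w ∅ = 1 := by
  simp [returnProb, walkFT]

lemma returnProb_singleton (hp : p ≠ 2) (w : ι → ZMod p) {j : ι} (hj : w j ≠ 0) :
    returnProb w {j} = 3 / 4 := by
  have h := returnProb_insert w (Finset.notMem_empty j)
  rw [walkProb_empty hp, if_neg hj, returnProb_empty] at h
  simpa using h

/-- The almost periods of the lazy walk. -/
def almostPeriods (w : ι → ZMod p) (S : Finset ι) : Finset (ZMod p) :=
  Finset.univ.filter fun a => 39 / 40 * returnProb w S ≤ walkProb w S a

lemma almostPeriods_congr {w w' : ι → ZMod p} {S : Finset ι} (h : ∀ j ∈ S, w j = w' j) :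
    almostPeriods w S = almostPeriods w' S := by
  have h1 : returnProb w S = returnProb w' S := by simp only [returnProb, walkFT_congr h]
  have h2 : walkProb w S = walkProb w' S := by funext a; simp only [walkProb, walkFT_congr h]
  unfold almostPeriods
  rw [h1, h2]

open scoped Pointwise in
lemma card_almostPeriods_mul_returnProb_le (hp : p ≠ 2) (w : ι → ZMod p) (S : Finset ι)
    (h1 : returnProb w S ≤ 3 / 4) (h2 : 2 < p * returnProb w S) :
    (almostPeriods w S).card * returnProb w S ≤ 19 / 20 := by
  set r := returnProb w S with hr
  set B := almostPeriods w S with hB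
  have hpp : (0 : ℝ) < p := by exact_mod_cast (Fact.out : p.Prime).pos
  have hr0 : 0 < r := by
    by_contra h
    nlinarith
  have h0 : (0 : ZMod p) ∈ B := by
    simp only [hB, almostPeriods, Finset.mem_filter, Finset.mem_univ, true_and, walkProb_zero]
    linarith
  have hsum : ((B + B).card : ℝ) * (9 / 10 * r) ≤ 1 := by
    rw [← sum_walkProb hp w S, ← nsmul_eq_mul]
    refine (Finset.card_nsmul_le_sum (B + B) (walkProb w S) _ ?_).trans
      (Finset.sum_le_sum_of_subset_of_nonneg (Finset.subset_univ _)
        fun a _ _ => walkProb_nonneg hp w S a)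
    intro x hx
    obtain ⟨a, ha, b, hb, rfl⟩ := Finset.mem_add.1 hx
    simp only [hB, almostPeriods, Finset.mem_filter, Finset.mem_univ, true_and] at ha hb
    have h := returnProb_sub_walkProb_add_le w S a b
    linarith
  have hcd := ZMod.cauchy_davenport (Fact.out : p.Prime) ⟨0, h0⟩ ⟨0, h0⟩ (s := B) (t := B)
  rcases min_le_iff.1 hcd with h | h
  · exfalso
    have h' : (p : ℝ) ≤ (B + B).card := by exact_mod_cast h
    nlinarith [mul_le_mul_of_nonneg_right h' hr0.le]
  · have h' : (2 * B.card : ℝ) - 1 ≤ (B + B).card := by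
      have : 2 * B.card ≤ (B + B).card + 1 := by omega
      have h3 : (2 * B.card : ℝ) ≤ (B + B).card + 1 := by exact_mod_cast this
      linarith
    nlinarith [mul_le_mul_of_nonneg_right h' hr0.le]

/-- A structured vector agrees, on `U`, with the almost periods of a short subwalk. -/
lemma exists_subset_almostPeriods (hp : p ≠ 2) (w : ι → ZMod p) {j₀ : ι} (hj₀ : w j₀ ≠ 0)
    (U : Finset ι) {β : ℝ} (hβ : β ≤ returnProb w U) {τ : ℕ}
    (hτ : (159 / 160 : ℝ) ^ τ < β / 2) :
    ∃ T : Finset ι, j₀ ∈ T ∧ T.card ≤ τ ∧ returnProb w T ≤ 3 / 4 ∧ β / 2 ≤ returnProb w T ∧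
      ∀ i ∈ U, i ∉ T → w i ∈ almostPeriods w T := by
  let F := (insert j₀ U).powerset.filter fun T =>
    j₀ ∈ T ∧ returnProb w T ≤ (159 / 160 : ℝ) ^ T.card
  have hne : F.Nonempty := by
    refine ⟨{j₀}, ?_⟩
    simp only [F, Finset.mem_filter, Finset.mem_powerset, Finset.singleton_subset_iff,
      Finset.mem_insert_self, Finset.mem_singleton, true_and, Finset.card_singleton,
      returnProb_singleton hp w hj₀]
    norm_num
  obtain ⟨T, hT, hmax⟩ := Finset.exists_max_image F Finset.card hne
  simp only [F, Finset.mem_filter, Finset.mem_powerset] at hT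
  obtain ⟨hTU, hjT, hTr⟩ := hT
  have hlow : β / 2 ≤ returnProb w T := by
    have h1 := returnProb_anti w hTU
    have h2 := half_returnProb_le_insert w (S := U) j₀
    linarith
  refine ⟨T, hjT, ?_, ?_, hlow, ?_⟩
  · by_contra! h
    have h3 : (159 / 160 : ℝ) ^ T.card ≤ (159 / 160 : ℝ) ^ τ :=
      pow_le_pow_of_le_one (by norm_num) (by norm_num) h.le
    linarith
  · rw [← returnProb_singleton hp w hj₀]
    exact returnProb_anti w (Finset.singleton_subset_iff.2 hjT)
  · intro i hiU hiT
    by_contra hi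
    simp only [almostPeriods, Finset.mem_filter, Finset.mem_univ, true_and, not_le] at hi
    have hmem : insert i T ∈ F := by
      simp only [F, Finset.mem_filter, Finset.mem_powerset]
      refine ⟨Finset.insert_subset (Finset.mem_insert_of_mem hiU) hTU,
        Finset.mem_insert_of_mem hjT, ?_⟩
      rw [Finset.card_insert_of_notMem hiT, pow_succ, returnProb_insert w hiT]
      linarith
    have := hmax _ hmem
    rw [Finset.card_insert_of_notMem hiT] at this
    omega

end Fourier

/-! ### Random signs and random symmetric matrices modulo `p` -/

/-- The probability of an event under the uniform distribution on a finite type. -/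
def unifProb {Ω : Type*} [Fintype Ω] (P : Ω → Prop) : ℝ := 𝔼 ω, if P ω then 1 else 0

lemma unifProb_def {Ω : Type*} [Fintype Ω] (P : Ω → Prop) [DecidablePred P] :
    unifProb P = 𝔼 ω, if P ω then 1 else 0 := by
  unfold unifProb
  congr!

lemma unifProb_nonneg {Ω : Type*} [Fintype Ω] (P : Ω → Prop) : 0 ≤ unifProb P :=
  Finset.expect_nonneg fun _ _ => by split_ifs <;> norm_num

lemma unifProb_mono {Ω : Type*} [Fintype Ω] {P Q : Ω → Prop} (h : ∀ ω, P ω → Q ω) :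
    unifProb P ≤ unifProb Q :=
  Finset.expect_le_expect fun ω _ => by
    by_cases hP : P ω
    · rw [if_pos hP, if_pos (h ω hP)]
    · rw [if_neg hP]; split_ifs <;> norm_num

lemma expect_pi_prod {ι κ R : Type*} [Fintype ι] [DecidableEq ι] [Fintype κ] [Field R] [CharZero R]
    (S : Finset ι) (f : ι → κ → R) [Nonempty κ] :
    𝔼 x : ι → κ, ∏ j ∈ S, f j (x j) = ∏ j ∈ S, 𝔼 b, f j b := by
  have h := Finset.prod_univ_sum (fun _ : ι => (Finset.univ : Finset κ))
    (fun j b => if j ∈ S then f j b else 1)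
  have hκ : (Fintype.card κ : R) ≠ 0 := by exact_mod_cast Fintype.card_ne_zero
  have h1 : ∀ x : ι → κ, (∏ j, if j ∈ S then f j (x j) else 1) = ∏ j ∈ S, f j (x j) := by
    intro x; simp [Finset.prod_ite_mem]
  have h2 : ∏ j ∈ S, 𝔼 b, f j b = ∏ j, (𝔼 b, if j ∈ S then f j b else 1) := by
    rw [← Finset.prod_subset (Finset.subset_univ S)]
    · exact Finset.prod_congr rfl fun j hj => by simp [hj]
    · intro j _ hj
      simp only [hj, if_false]
      exact Fintype.expect_const 1
  rw [h2]
  simp only [Fintype.expect_eq_sum_div_card, Finset.prod_div_distrib]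
  rw [h, Fintype.piFinset_univ, Finset.sum_congr rfl fun x _ => h1 x]
  simp

section Random

variable {p : ℕ} [Fact p.Prime]

/-- The sign in `ZMod p` corresponding to a Boolean. -/
def signMod (p : ℕ) (b : Bool) : ZMod p := if b then 1 else -1

lemma signMod_beq (a b : Bool) : signMod p (a == b) = signMod p a * signMod p b := by
  cases a <;> cases b <;> simp [signMod]

lemma norm_stdAddChar (x : ZMod p) : ‖(ZMod.stdAddChar x : ℂ)‖ = 1 := by
  rw [ZMod.stdAddChar_apply]; exact Circle.norm_coe _

lemma stdAddChar_sum {ι : Type*} (S : Finset ι) (f : ι → ZMod p) :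
    (ZMod.stdAddChar (∑ j ∈ S, f j) : ℂ) = ∏ j ∈ S, ZMod.stdAddChar (f j) := by
  induction S using Finset.induction_on with
  | empty => simp
  | insert j S hj ih => rw [Finset.sum_insert hj, Finset.prod_insert hj, AddChar.map_add_eq_mul, ih]

lemma expect_stdAddChar_signMod (x : ZMod p) :
    𝔼 b : Bool, (ZMod.stdAddChar (signMod p b * x) : ℂ) = cosChar x := by
  have h := stdAddChar_neg_re x
  rw [Fintype.expect_eq_sum_div_card]
  simp only [Fintype.univ_bool, signMod, Fintype.card_bool]
  apply Complex.ext
  · simp [cosChar, h.1, ← Complex.ofReal_ofNat, Complex.div_ofReal_re]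
  · simp [cosChar, h.2, ← Complex.ofReal_ofNat, Complex.div_ofReal_im]

lemma unifProb_sum_signMod_le {ι : Type*} [Fintype ι] [DecidableEq ι] (w : ι → ZMod p) (S : Finset ι)
    (b : ZMod p) :
    unifProb (fun x : ι → Bool => ∑ j ∈ S, signMod p (x j) * w j = b) ≤ returnProb w S := by
  have hC : ((unifProb (fun x : ι → Bool => ∑ j ∈ S, signMod p (x j) * w j = b) : ℝ) : ℂ) =
      𝔼 t : ZMod p, (ZMod.stdAddChar (t * -b) : ℂ) * ∏ j ∈ S, (cosChar (t * w j) : ℂ) := by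
    have h1 : ((unifProb (fun x : ι → Bool => ∑ j ∈ S, signMod p (x j) * w j = b) : ℝ) : ℂ) =
        𝔼 x : ι → Bool, 𝔼 t : ZMod p,
          (ZMod.stdAddChar (t * (∑ j ∈ S, signMod p (x j) * w j - b)) : ℂ) := by
      simp only [expect_stdAddChar, sub_eq_zero]
      rw [unifProb_def]
      simp only [Fintype.expect_eq_sum_div_card]
      push_cast
      congr 1
      exact Finset.sum_congr rfl fun x _ => by split_ifs <;> simp
    rw [h1, Finset.expect_comm]
    refine Finset.expect_congr rfl fun t _ => ?_
    have h2 : ∀ x : ι → Bool,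
        (ZMod.stdAddChar (t * (∑ j ∈ S, signMod p (x j) * w j - b)) : ℂ) =
        ZMod.stdAddChar (t * -b) * ∏ j ∈ S, ZMod.stdAddChar (signMod p (x j) * (t * w j)) := by
      intro x
      rw [← stdAddChar_sum, ← AddChar.map_add_eq_mul]
      congr 1
      rw [sub_eq_add_neg, mul_add, Finset.mul_sum, add_comm]
      congr 1
      exact Finset.sum_congr rfl fun j _ => by ring
    simp only [h2, ← Finset.mul_expect]
    rw [expect_pi_prod S (fun j b => (ZMod.stdAddChar (signMod p b * (t * w j)) : ℂ))]
    simp only [expect_stdAddChar_signMod]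
  have hn : unifProb (fun x : ι → Bool => ∑ j ∈ S, signMod p (x j) * w j = b) =
      ‖((unifProb (fun x : ι → Bool => ∑ j ∈ S, signMod p (x j) * w j = b) : ℝ) : ℂ)‖ := by
    rw [Complex.norm_real, Real.norm_of_nonneg (unifProb_nonneg _)]
  rw [hn, hC, Fintype.expect_eq_sum_div_card, norm_div, Complex.norm_natCast]
  unfold returnProb
  rw [Fintype.expect_eq_sum_div_card]
  gcongr
  refine norm_sum_le_of_le _ fun t _ => ?_
  rw [norm_mul, norm_stdAddChar, one_mul, norm_prod]
  refine Finset.prod_le_prod (fun _ _ => norm_nonneg _) fun j _ => ?_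
  rw [Complex.norm_real, Real.norm_eq_abs, ← sq_abs (cosChar _)]
  nlinarith [sq_nonneg (|cosChar (t * w j)| - 1)]

/-- The sign bit of the entry `(i, j)` of a symmetric matrix. -/
def symBit {m : ℕ} (g : Fin m → Fin m → Bool) (i j : Fin m) : Bool :=
  if i ≤ j then g i j else g j i

/-- The random symmetric sign matrix with entries in `ZMod p`. -/
def symMod (p : ℕ) (m : ℕ) (g : Fin m → Fin m → Bool) : Matrix (Fin m) (Fin m) (ZMod p) :=
  Matrix.of fun i j => signMod p (symBit g i j)

lemma symBit_comm {m : ℕ} (g : Fin m → Fin m → Bool) (i j : Fin m) :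
    symBit g i j = symBit g j i := by
  unfold symBit
  rcases lt_trichotomy i j with h | h | h
  · rw [if_pos h.le, if_neg h.not_ge]
  · rw [h]
  · rw [if_neg h.not_ge, if_pos h.le]

/-- Resample the bits of the entries with row outside `T` and column in `T`, and their mirror
images. -/
def resample {m : ℕ} (T : Finset (Fin m)) (h g : Fin m → Fin m → Bool) : Fin m → Fin m → Bool :=
  fun a b => if a ∉ T ∧ b ∈ T then g a b == h a b
    else if b ∉ T ∧ a ∈ T then g a b == h b a else g a b

lemma resample_involutive {m : ℕ} (T : Finset (Fin m)) (h : Fin m → Fin m → Bool) :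
    Function.Involutive (resample T h) := by
  intro g
  funext a b
  have key : ∀ x y : Bool, ((x == y) == y) = x := by decide
  unfold resample
  split_ifs <;> simp only [key]

lemma symBit_resample {m : ℕ} (T : Finset (Fin m)) (h g : Fin m → Fin m → Bool) {i : Fin m}
    (hi : i ∉ T) (j : Fin m) :
    symBit (resample T h g) i j = if j ∈ T then symBit g i j == h i j else symBit g i j := by
  have h1 : resample T h g i j = if j ∈ T then g i j == h i j else g i j := by
    simp [resample, hi]
  have h2 : resample T h g j i = if j ∈ T then g j i == h i j else g j i := by
    simp [resample, hi]
  unfold symBit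
  rw [h1, h2]
  split_ifs <;> rfl

lemma unifProb_symMod_mulVec_le {m : ℕ} (w z : Fin m → ZMod p) (T : Finset (Fin m)) :
    unifProb (fun g => (symMod p m g).mulVec w = z) ≤ returnProb w T ^ (m - T.card) := by
  have h1 : unifProb (fun g => (symMod p m g).mulVec w = z) =
      𝔼 g : Fin m → Fin m → Bool, 𝔼 h : Fin m → Fin m → Bool,
        if (symMod p m (resample T h g)).mulVec w = z then (1 : ℝ) else 0 := by
    rw [Finset.expect_comm]
    rw [unifProb_def]
    have : ∀ h : Fin m → Fin m → Bool, (𝔼 g : Fin m → Fin m → Bool,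
        if (symMod p m (resample T h g)).mulVec w = z then (1 : ℝ) else 0) =
        𝔼 g : Fin m → Fin m → Bool, if (symMod p m g).mulVec w = z then 1 else 0 := fun h =>
      Fintype.expect_equiv (resample_involutive T h).toPerm _ _ fun g => by
        rw [Function.Involutive.coe_toPerm]
    simp only [this]
    rw [Fintype.expect_const]
  rw [h1]
  refine Finset.expect_le Finset.univ_nonempty fun g _ => ?_
  let w' : Fin m → Fin m → ZMod p := fun i j => signMod p (symBit g i j) * w j
  let r : Fin m → ZMod p := fun i => z i - ∑ j ∈ Tᶜ, signMod p (symBit g i j) * w j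
  calc 𝔼 h : Fin m → Fin m → Bool,
        (if (symMod p m (resample T h g)).mulVec w = z then (1 : ℝ) else 0)
      ≤ 𝔼 h : Fin m → Fin m → Bool, ∏ i ∈ Tᶜ,
          (if ∑ j ∈ T, signMod p (h i j) * w' i j = r i then (1 : ℝ) else 0) := by
        refine Finset.expect_le_expect fun h _ => ?_
        split_ifs with hz
        · refine (Finset.prod_eq_one fun i hi => if_pos ?_).ge
          have hi' : i ∉ T := Finset.mem_compl.1 hi
          have hzi := congrFun hz i
          simp only [Matrix.mulVec, dotProduct, symMod, Matrix.of_apply,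
            symBit_resample T h g hi'] at hzi
          rw [← Finset.sum_add_sum_compl T] at hzi
          simp only [r, ← hzi, w']
          rw [eq_sub_iff_add_eq]
          congr 1
          · refine Finset.sum_congr rfl fun j hj => ?_
            rw [if_pos hj, signMod_beq]
            ring
          · refine Finset.sum_congr rfl fun j hj => ?_
            rw [if_neg (Finset.mem_compl.1 hj)]
        · exact Finset.prod_nonneg fun _ _ => by split_ifs <;> norm_num
    _ = ∏ i ∈ Tᶜ, unifProb (fun x : Fin m → Bool =>
          ∑ j ∈ T, signMod p (x j) * w' i j = r i) := by
        simp only [unifProb_def]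
        exact expect_pi_prod Tᶜ fun i (x : Fin m → Bool) =>
          if ∑ j ∈ T, signMod p (x j) * w' i j = r i then (1 : ℝ) else 0
    _ ≤ ∏ i ∈ Tᶜ, returnProb w T := by
        refine Finset.prod_le_prod (fun _ _ => unifProb_nonneg _) fun i _ => ?_
        refine (unifProb_sum_signMod_le _ _ _).trans_eq ?_
        unfold returnProb
        rw [walkFT_congr_sign (w := w' i) (w' := w)]
        intro j _
        simp only [w', signMod]
        split_ifs <;> simp
    _ = returnProb w T ^ (m - T.card) := by
        rw [Finset.prod_const, Finset.card_compl, Fintype.card_fin]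

end Random

/-! ### Structured solutions are unlikely -/

lemma unifProb_exists_le {Ω α : Type*} [Fintype Ω] (s : Finset α) (P : α → Ω → Prop) :
    unifProb (fun ω => ∃ a ∈ s, P a ω) ≤ ∑ a ∈ s, unifProb (P a) := by
  unfold unifProb
  rw [← Finset.expect_sum_comm]
  refine Finset.expect_le_expect fun ω _ => ?_
  split_ifs with h
  · obtain ⟨a, ha, hP⟩ := h
    have h1 := Finset.single_le_sum (f := fun a => if P a ω then (1 : ℝ) else 0) (s := s)
      (fun a _ => by split_ifs <;> norm_num) ha
    simpa [hP] using h1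
  · exact Finset.sum_nonneg fun _ _ => by split_ifs <;> norm_num

lemma exists_image_univ_eq {m τ : ℕ} {T : Finset (Fin m)} (hT : T.Nonempty) (hc : T.card ≤ τ) :
    ∃ f : Fin τ → Fin m, Finset.univ.image f = T := by
  obtain ⟨t₀, ht₀⟩ := hT
  have : Nonempty T := ⟨⟨t₀, ht₀⟩⟩
  have hcard : Fintype.card T ≤ Fintype.card (Fin τ) := by simpa using hc
  obtain ⟨e⟩ := Function.Embedding.nonempty_of_card_le hcard
  refine ⟨fun i => (Function.invFun e i : T), ?_⟩
  ext t
  simp only [Finset.mem_image, Finset.mem_univ, true_and]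
  constructor
  · rintro ⟨i, rfl⟩
    exact (Function.invFun e i).2
  · intro ht
    exact ⟨e ⟨t, ht⟩, by rw [Function.leftInverse_invFun e.injective]⟩

section Structured

variable {p : ℕ} [Fact p.Prime] {m : ℕ}

/-- The vectors supported in `T`. -/
def vecsSupportedIn (p : ℕ) [Fact p.Prime] (T : Finset (Fin m)) : Finset (Fin m → ZMod p) :=
  Fintype.piFinset fun i => if i ∈ T then Finset.univ else {0}

/-- The vectors equal to `a` on `T` all of whose other coordinates in `U` are almost periods of
the walk given by the restriction of `a` to `T`. -/
def structuredExtensions (U T : Finset (Fin m)) (a : Fin m → ZMod p) :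
    Finset (Fin m → ZMod p) :=
  Fintype.piFinset fun i => if i ∈ T then {a i} else if i ∈ U then almostPeriods a T else
    Finset.univ

lemma card_vecsSupportedIn (T : Finset (Fin m)) : (vecsSupportedIn p T).card = p ^ T.card := by
  rw [vecsSupportedIn, Fintype.card_piFinset]
  simp only [apply_ite Finset.card, Finset.card_univ, ZMod.card, Finset.card_singleton]
  rw [Finset.prod_ite_mem, Finset.univ_inter, Finset.prod_const]

lemma card_structuredExtensions_mul_le (hp : p ≠ 2) (U T : Finset (Fin m))
    (a : Fin m → ZMod p) (h1 : returnProb a T ≤ 3 / 4) (h2 : 2 < p * returnProb a T) :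
    (structuredExtensions U T a).card * returnProb a T ^ (m - T.card) ≤
      (p : ℝ) ^ Uᶜ.card * (19 / 20 : ℝ) ^ (m - T.card - Uᶜ.card) := by
  have hp1 : (1 : ℝ) ≤ p := by exact_mod_cast (Fact.out : p.Prime).one_lt.le
  have hpow : returnProb a T ^ (m - T.card) = ∏ i : Fin m, if i ∈ T then 1 else returnProb a T := by
    have h : ∀ i : Fin m, (if i ∈ T then (1 : ℝ) else returnProb a T) =
        if i ∈ Tᶜ then returnProb a T else 1 := fun i => by
      by_cases h : i ∈ T <;> simp [h]
    rw [Finset.prod_congr rfl fun i _ => h i, Finset.prod_ite_mem, Finset.univ_inter,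
      Finset.prod_const, Finset.card_compl, Fintype.card_fin]
  rw [structuredExtensions, Fintype.card_piFinset, Nat.cast_prod, hpow, ← Finset.prod_mul_distrib]
  have hle : ∏ i : Fin m, ((((if i ∈ T then {a i} else if i ∈ U then almostPeriods a T else
      Finset.univ : Finset (ZMod p)).card : ℕ) : ℝ) * if i ∈ T then 1 else returnProb a T) ≤
      ∏ i : Fin m, ((if i ∈ Uᶜ then (p : ℝ) else 1) *
        if i ∈ U \ T then (19 / 20 : ℝ) else 1) := by
    refine Finset.prod_le_prod (fun i _ => ?_) fun i _ => ?_
    · have := returnProb_nonneg a T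
      split_ifs <;> positivity
    · by_cases hT : i ∈ T
      · by_cases hU : i ∈ U <;> simp [hT, hU, hp1]
      · by_cases hU : i ∈ U
        · simpa [hT, hU] using card_almostPeriods_mul_returnProb_le hp a T h1 h2
        · simp only [hT, hU, if_false, Finset.card_univ, ZMod.card, Finset.mem_compl,
            not_false_iff, if_true, Finset.mem_sdiff, false_and]
          nlinarith
  refine hle.trans ?_
  rw [Finset.prod_mul_distrib, Finset.prod_ite_mem, Finset.prod_ite_mem, Finset.univ_inter,
    Finset.univ_inter, Finset.prod_const, Finset.prod_const]
  refine mul_le_mul_of_nonneg_left ?_ (by positivity)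
  refine pow_le_pow_of_le_one (by norm_num) (by norm_num) ?_
  have h3 := Finset.le_card_sdiff T U
  have h4 := Finset.card_compl U
  rw [Fintype.card_fin] at h4
  have h5 := Finset.card_le_univ U
  rw [Fintype.card_fin] at h5
  omega

/-- `symMod p m g` maps some nonzero `w`, structured on `U`, to `z`. -/
def HasStructuredSolution (p : ℕ) [Fact p.Prime] (U : Finset (Fin m)) (β : ℝ)
    (z : Fin m → ZMod p) (g : Fin m → Fin m → Bool) : Prop :=
  ∃ w : Fin m → ZMod p, w ≠ 0 ∧ β ≤ returnProb w U ∧ (symMod p m g).mulVec w = z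

lemma unifProb_hasStructuredSolution_le (hp : p ≠ 2) (hmp : m ≤ p) (U : Finset (Fin m)) {β : ℝ}
    (hβ : 4 < p * β) {τ : ℕ} (hτ : (159 / 160 : ℝ) ^ τ < β / 2) (z : Fin m → ZMod p) :
    unifProb (HasStructuredSolution p U β z) ≤
      (p : ℝ) ^ (2 * τ + Uᶜ.card) * (19 / 20 : ℝ) ^ (m - τ - Uᶜ.card) := by
  have hp1 : (1 : ℝ) ≤ p := by exact_mod_cast (Fact.out : p.Prime).one_lt.le
  let X : (Fin τ → Fin m) → Finset (Fin m) := fun f => Finset.univ.image f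
  let A : (Fin τ → Fin m) → Finset (Fin m → ZMod p) := fun f =>
    (vecsSupportedIn p (X f)).filter fun a =>
      returnProb a (X f) ≤ 3 / 4 ∧ β / 2 ≤ returnProb a (X f)
  have hX : ∀ f, (X f).card ≤ τ := fun f => Finset.card_image_le.trans_eq (by simp)
  have hmono : ∀ g : Fin m → Fin m → Bool, HasStructuredSolution p U β z g →
      ∃ f ∈ (Finset.univ : Finset (Fin τ → Fin m)), ∃ a ∈ A f,
        ∃ w ∈ structuredExtensions U (X f) a, (symMod p m g).mulVec w = z := by
    rintro g ⟨w, hw0, hwβ, hwz⟩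
    obtain ⟨j₀, hj₀⟩ := Function.ne_iff.1 hw0
    obtain ⟨T, hjT, hTτ, hT1, hT2, hT3⟩ := exists_subset_almostPeriods hp w hj₀ U hwβ hτ
    obtain ⟨f, rfl⟩ := exists_image_univ_eq ⟨j₀, hjT⟩ hTτ
    let a : Fin m → ZMod p := fun i => if i ∈ X f then w i else 0
    have haw : ∀ j ∈ X f, a j = w j := fun j hj => if_pos hj
    have hr : returnProb a (X f) = returnProb w (X f) := by
      unfold returnProb
      rw [walkFT_congr haw]
    refine ⟨f, Finset.mem_univ _, a, ?_, w, ?_, hwz⟩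
    · simp only [A, Finset.mem_filter, hr]
      refine ⟨?_, hT1, hT2⟩
      rw [vecsSupportedIn, Fintype.mem_piFinset]
      intro i
      by_cases hi : i ∈ X f <;> simp [hi, a]
    · rw [structuredExtensions, Fintype.mem_piFinset, almostPeriods_congr haw]
      intro i
      by_cases hi : i ∈ X f
      · simp [hi, a]
      · by_cases hU : i ∈ U
        · simpa only [hi, hU, if_false, if_true] using hT3 i hU hi
        · simp [hi, hU]
  have hWbound : ∀ f, ∀ a ∈ A f, ∑ w ∈ structuredExtensions U (X f) a,
      unifProb (fun g => (symMod p m g).mulVec w = z) ≤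
      (p : ℝ) ^ Uᶜ.card * (19 / 20 : ℝ) ^ (m - τ - Uᶜ.card) := by
    intro f a ha
    simp only [A, Finset.mem_filter] at ha
    obtain ⟨-, h1, h2⟩ := ha
    calc ∑ w ∈ structuredExtensions U (X f) a, unifProb (fun g => (symMod p m g).mulVec w = z)
        ≤ ∑ w ∈ structuredExtensions U (X f) a, returnProb a (X f) ^ (m - (X f).card) := by
          refine Finset.sum_le_sum fun w hw => ?_
          have hwa : returnProb w (X f) = returnProb a (X f) := by
            unfold returnProb
            rw [walkFT_congr fun j hj => ?_]
            have h := Fintype.mem_piFinset.1 hw j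
            rwa [if_pos hj, Finset.mem_singleton] at h
          rw [← hwa]
          exact unifProb_symMod_mulVec_le w z (X f)
      _ = (structuredExtensions U (X f) a).card * returnProb a (X f) ^ (m - (X f).card) := by
          rw [Finset.sum_const, nsmul_eq_mul]
      _ ≤ (p : ℝ) ^ Uᶜ.card * (19 / 20 : ℝ) ^ (m - (X f).card - Uᶜ.card) :=
          card_structuredExtensions_mul_le hp U (X f) a h1 (by nlinarith)
      _ ≤ _ := by
          refine mul_le_mul_of_nonneg_left ?_ (by positivity)
          refine pow_le_pow_of_le_one (by norm_num) (by norm_num) ?_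
          have := hX f
          omega
  set b : ℝ := (p : ℝ) ^ Uᶜ.card * (19 / 20 : ℝ) ^ (m - τ - Uᶜ.card) with hb
  have hb0 : 0 ≤ b := by positivity
  calc unifProb (HasStructuredSolution p U β z)
      ≤ ∑ f : Fin τ → Fin m, ∑ a ∈ A f, ∑ w ∈ structuredExtensions U (X f) a,
          unifProb (fun g => (symMod p m g).mulVec w = z) := by
        refine (unifProb_mono hmono).trans ((unifProb_exists_le _ _).trans ?_)
        refine Finset.sum_le_sum fun f _ => (unifProb_exists_le _ _).trans ?_
        exact Finset.sum_le_sum fun a _ => unifProb_exists_le _ _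
    _ ≤ ∑ f : Fin τ → Fin m, (p : ℝ) ^ τ * b := by
        refine Finset.sum_le_sum fun f _ => ?_
        refine (Finset.sum_le_sum (hWbound f)).trans ?_
        rw [Finset.sum_const, nsmul_eq_mul]
        refine mul_le_mul_of_nonneg_right ?_ hb0
        have h1 : (A f).card ≤ p ^ (X f).card :=
          (Finset.card_filter_le _ _).trans_eq (card_vecsSupportedIn _)
        calc ((A f).card : ℝ) ≤ (p : ℝ) ^ (X f).card := by exact_mod_cast h1
          _ ≤ (p : ℝ) ^ τ := pow_le_pow_right₀ hp1 (hX f)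
    _ = (m : ℝ) ^ τ * ((p : ℝ) ^ τ * b) := by
        rw [Finset.sum_const, nsmul_eq_mul]
        simp
    _ ≤ (p : ℝ) ^ τ * ((p : ℝ) ^ τ * b) := by
        gcongr
    _ = _ := by
        rw [hb, pow_add, two_mul, pow_add]
        ring

end Structured

/-! ### Adding one row and one column -/

section Border

variable {p : ℕ} [Fact p.Prime] {m : ℕ}

/-- The dimension of the kernel of a square matrix. -/
def corank {n : ℕ} (A : Matrix (Fin n) (Fin n) (ZMod p)) : ℕ :=
  Module.finrank (ZMod p) (LinearMap.ker A.mulVecLin)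

lemma corank_le {n : ℕ} (A : Matrix (Fin n) (Fin n) (ZMod p)) : corank A ≤ n := by
  have h := Submodule.finrank_le (LinearMap.ker A.mulVecLin)
  rwa [Module.finrank_fin_fun] at h

lemma exists_mulVec_eq_zero_of_corank_pos {n : ℕ} {A : Matrix (Fin n) (Fin n) (ZMod p)}
    (h : 0 < corank A) : ∃ v ≠ 0, A.mulVec v = 0 := by
  have hne : LinearMap.ker A.mulVecLin ≠ ⊥ := by
    intro hb
    rw [corank, hb, finrank_bot] at h
    exact lt_irrefl _ h
  obtain ⟨v, hv, hv0⟩ := Submodule.exists_mem_ne_zero_of_ne_bot hne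
  exact ⟨v, hv0, by simpa using hv⟩

lemma corank_pos_of_det_eq_zero {n : ℕ} {A : Matrix (Fin n) (Fin n) (ZMod p)}
    (h : A.det = 0) : 0 < corank A := by
  obtain ⟨v, hv0, hv⟩ := Matrix.exists_mulVec_eq_zero_iff.2 h
  rw [corank, Module.finrank_pos_iff_exists_ne_zero]
  exact ⟨⟨v, by simpa using hv⟩, by simpa [Subtype.ext_iff] using hv0⟩

/-- The decomposition of a sign array into its principal part, its last column, its last row and
its corner. -/
def borderEquiv (m : ℕ) : (Fin (m + 1) → Fin (m + 1) → Bool) ≃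
    ((Fin m → Bool) × Bool) × (Fin m → Fin m → Bool) × (Fin m → Bool) where
  toFun G := ((fun j => G (Fin.last m) j.castSucc, G (Fin.last m) (Fin.last m)),
    fun i j => G i.castSucc j.castSucc, fun i => G i.castSucc (Fin.last m))
  invFun q := fun i j => Fin.lastCases (motive := fun _ => Bool)
    (Fin.lastCases (motive := fun _ => Bool) q.1.2 q.1.1 j)
    (fun i' => Fin.lastCases (motive := fun _ => Bool) (q.2.2 i') (q.2.1 i') j) i
  left_inv G := by
    funext i j
    refine Fin.lastCases ?_ (fun i' => ?_) i <;> refine Fin.lastCases ?_ (fun j' => ?_) j <;> simp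
  right_inv q := by
    obtain ⟨⟨y, d⟩, g, x⟩ := q
    simp

/-- The sign array with principal part `g`, last column `x`, and last row and corner `e`. -/
def bordered (e : (Fin m → Bool) × Bool) (g : Fin m → Fin m → Bool) (x : Fin m → Bool) :
    Fin (m + 1) → Fin (m + 1) → Bool := (borderEquiv m).symm (e, g, x)

/-- A vector of signs, with entries in `ZMod p`. -/
def signVec (p : ℕ) (x : Fin m → Bool) : Fin m → ZMod p := fun i => signMod p (x i)

lemma symMod_bordered_mulVec_castSucc (e : (Fin m → Bool) × Bool) (g : Fin m → Fin m → Bool)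
    (x : Fin m → Bool) (v : Fin (m + 1) → ZMod p) (i : Fin m) :
    (symMod p (m + 1) (bordered e g x)).mulVec v i.castSucc =
      (symMod p m g).mulVec (fun j => v j.castSucc) i + signVec p x i * v (Fin.last m) := by
  have h1 : ∀ j : Fin m, symBit (bordered e g x) i.castSucc j.castSucc = symBit g i j := by
    intro j
    simp [symBit, bordered, borderEquiv]
  have h2 : symBit (bordered e g x) i.castSucc (Fin.last m) = x i := by
    simp [symBit, bordered, borderEquiv, Fin.le_last]
  simp only [Matrix.mulVec, dotProduct, symMod, Matrix.of_apply, Fin.sum_univ_castSucc, h1, h2,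
    signVec]

lemma symMod_bordered_mulVec_last (e : (Fin m → Bool) × Bool) (g : Fin m → Fin m → Bool)
    (x : Fin m → Bool) (v : Fin (m + 1) → ZMod p) :
    (symMod p (m + 1) (bordered e g x)).mulVec v (Fin.last m) =
      dotProduct (signVec p x) (fun j => v j.castSucc) + signMod p e.2 * v (Fin.last m) := by
  have h1 : ∀ j : Fin m, symBit (bordered e g x) (Fin.last m) j.castSucc = x j := by
    intro j
    rw [symBit_comm]
    simp [symBit, bordered, borderEquiv, Fin.le_last]
  have h2 : symBit (bordered e g x) (Fin.last m) (Fin.last m) = e.2 := by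
    simp [symBit, bordered, borderEquiv]
  simp only [Matrix.mulVec, dotProduct, symMod, Matrix.of_apply, Fin.sum_univ_castSucc, h1, h2,
    signVec]

lemma dotProduct_symMod_mulVec (g : Fin m → Fin m → Bool) (v w : Fin m → ZMod p) :
    dotProduct v ((symMod p m g).mulVec w) = dotProduct ((symMod p m g).mulVec v) w := by
  have htr : (symMod p m g).transpose = symMod p m g := by
    ext i j
    simp only [symMod, Matrix.transpose_apply, Matrix.of_apply, symBit_comm g j i]
  rw [Matrix.dotProduct_mulVec, ← Matrix.mulVec_transpose, htr]

lemma corank_bordered_lt (e : (Fin m → Bool) × Bool) (g : Fin m → Fin m → Bool)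
    (x : Fin m → Bool) {v₀ : Fin m → ZMod p} (hv₀ : (symMod p m g).mulVec v₀ = 0)
    (hx : dotProduct (signVec p x) v₀ ≠ 0) :
    corank (symMod p (m + 1) (bordered e g x)) < corank (symMod p m g) := by
  set K := LinearMap.ker (symMod p (m + 1) (bordered e g x)).mulVecLin with hK
  let π : (Fin (m + 1) → ZMod p) →ₗ[ZMod p] (Fin m → ZMod p) :=
    LinearMap.funLeft (ZMod p) (ZMod p) Fin.castSucc
  have hmem : ∀ v ∈ K, v (Fin.last m) = 0 ∧ (symMod p m g).mulVec (π v) = 0 ∧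
      dotProduct (signVec p x) (π v) = 0 := by
    intro v hv
    have hv' : (symMod p (m + 1) (bordered e g x)).mulVec v = 0 := by simpa [hK] using hv
    have h1 : (symMod p m g).mulVec (π v) + v (Fin.last m) • signVec p x = 0 := by
      funext i
      have h := congrFun hv' i.castSucc
      rw [symMod_bordered_mulVec_castSucc] at h
      simp only [Pi.add_apply, Pi.smul_apply, smul_eq_mul, Pi.zero_apply]
      rw [mul_comm]
      exact h
    have h2 := congrFun hv' (Fin.last m)
    rw [symMod_bordered_mulVec_last] at h2
    have h3 : v (Fin.last m) = 0 := by
      have h4 := congrArg (dotProduct v₀) h1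
      rw [dotProduct_add, dotProduct_symMod_mulVec, hv₀, zero_dotProduct, zero_add,
        dotProduct_smul, dotProduct_zero, dotProduct_comm, smul_eq_mul] at h4
      exact (mul_eq_zero.1 h4).resolve_right hx
    rw [h3, zero_smul, add_zero] at h1
    rw [h3, mul_zero, add_zero] at h2
    exact ⟨h3, h1, h2⟩
  have hinj : Function.Injective (π.domRestrict K) := by
    rw [← LinearMap.ker_eq_bot, LinearMap.ker_eq_bot']
    intro v hv
    ext i
    refine Fin.lastCases ?_ (fun i' => ?_) i
    · exact (hmem v v.2).1
    · exact congrFun hv i'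
  have hlt : K.map π < LinearMap.ker (symMod p m g).mulVecLin := by
    refine lt_of_le_of_ne ?_ ?_
    · rintro _ ⟨v, hv, rfl⟩
      simpa using (hmem v hv).2.1
    · intro heq
      have h1 : v₀ ∈ K.map π := by
        rw [heq]; simpa using hv₀
      obtain ⟨v, hv, rfl⟩ := h1
      exact hx (hmem v hv).2.2
  calc corank (symMod p (m + 1) (bordered e g x))
      = Module.finrank (ZMod p) (K.map π) := by
        rw [← LinearMap.range_domRestrict, LinearMap.finrank_range_of_inj hinj]; rfl
    _ < corank (symMod p m g) := Submodule.finrank_lt_finrank_of_lt hlt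

/-- The symmetric matrix given by `g` is nonsingular, but bordering it by `x` and `d` makes it
singular. -/
def SingularBordering (p : ℕ) [Fact p.Prime] (d : ZMod p) (g : Fin m → Fin m → Bool)
    (x : Fin m → Bool) : Prop :=
  (∀ v, (symMod p m g).mulVec v = 0 → v = 0) ∧
    ∃ v, (symMod p m g).mulVec v = signVec p x ∧ dotProduct (signVec p x) v = d

lemma singularBordering_of_corank_pos (e : (Fin m → Bool) × Bool) (g : Fin m → Fin m → Bool)
    (x : Fin m → Bool) (h0 : ∀ v, (symMod p m g).mulVec v = 0 → v = 0)
    (h : 0 < corank (symMod p (m + 1) (bordered e g x))) :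
    SingularBordering p (signMod p e.2) g x := by
  obtain ⟨v, hv0, hv⟩ := exists_mulVec_eq_zero_of_corank_pos h
  set v' : Fin m → ZMod p := fun j => v j.castSucc with hv'
  set s := v (Fin.last m) with hs
  have h1 : (symMod p m g).mulVec v' = - (s • signVec p x) := by
    funext i
    have h := congrFun hv i.castSucc
    rw [symMod_bordered_mulVec_castSucc] at h
    simp only [Pi.neg_apply, Pi.smul_apply, smul_eq_mul]
    rw [mul_comm]
    exact eq_neg_of_add_eq_zero_left h
  have h2 : dotProduct (signVec p x) v' = - (signMod p e.2 * s) := by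
    have h := congrFun hv (Fin.last m)
    rw [symMod_bordered_mulVec_last] at h
    exact eq_neg_of_add_eq_zero_left h
  have hs0 : s ≠ 0 := by
    intro hs0
    rw [hs0, zero_smul, neg_zero] at h1
    have h3 := h0 v' h1
    apply hv0
    funext i
    refine Fin.lastCases ?_ (fun i' => ?_) i
    · exact hs0
    · exact congrFun h3 i'
  refine ⟨h0, -(s⁻¹ • v'), ?_, ?_⟩
  · rw [Matrix.mulVec_neg, Matrix.mulVec_smul, h1, smul_neg, neg_neg, smul_smul,
      inv_mul_cancel₀ hs0, one_smul]
  · rw [dotProduct_neg, dotProduct_smul, h2, smul_neg, neg_neg, smul_eq_mul]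
    field_simp

lemma SingularBordering.sub {d : ZMod p} {g : Fin m → Fin m → Bool} {x x' : Fin m → Bool}
    (h : SingularBordering p d g x) (h' : SingularBordering p d g x') :
    ∃ w, (symMod p m g).mulVec w = signVec p x - signVec p x' ∧
      dotProduct (signVec p x + signVec p x') w = 0 := by
  obtain ⟨-, v, hv, hd⟩ := h
  obtain ⟨-, v', hv', hd'⟩ := h'
  refine ⟨v - v', by rw [Matrix.mulVec_sub, hv, hv'], ?_⟩
  have h1 : dotProduct (signVec p x) v' = dotProduct (signVec p x') v := by
    rw [← hv, ← dotProduct_symMod_mulVec, hv', dotProduct_comm]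
  rw [add_dotProduct, dotProduct_sub, dotProduct_sub, hd, hd', h1]
  ring

end Border

/-! ### The probability that bordering creates or keeps a kernel -/

section Merge

variable {ι : Type*}

/-- The sign pattern equal to `u` on `U` and to `y` off `U`. -/
def merge (U : Finset ι) (y u : ι → Bool) : ι → Bool := fun i => if i ∈ U then u i else y i

lemma expect_merge [Fintype ι] [DecidableEq ι] (U : Finset ι) (F : (ι → Bool) → ℝ) :
    𝔼 y, 𝔼 u, F (merge U y u) = 𝔼 x, F x := by
  have hinv : Function.Involutive fun q : (ι → Bool) × (ι → Bool) =>
      (merge U q.1 q.2, merge U q.2 q.1) := by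
    rintro ⟨y, u⟩
    ext i <;> by_cases hi : i ∈ U <;> simp [merge, hi]
  rw [← Finset.expect_product' (f := fun y u => F (merge U y u)), Finset.univ_product_univ,
    Fintype.expect_equiv (hinv.toPerm _) (fun q => F (merge U q.1 q.2)) (fun q => F q.1)
      (fun q => rfl),
    ← Finset.univ_product_univ, Finset.expect_product' (f := fun y _ => F y)]
  simp

lemma sq_expect_le_expect_sq {Ω : Type*} [Fintype Ω] [Nonempty Ω] (f : Ω → ℝ) :
    (𝔼 ω, f ω) ^ 2 ≤ 𝔼 ω, f ω ^ 2 := by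
  simpa using Finset.expect_mul_sq_le_sq_mul_sq Finset.univ f (fun _ => 1)

lemma sq_expect_expect_le {Ω : Type*} [Fintype Ω] [Nonempty Ω] [Fintype ι]
    [DecidableEq ι] (U : Finset ι)
    (F : Ω → (ι → Bool) → ℝ) :
    (𝔼 ω, 𝔼 x, F ω x) ^ 2 ≤
      𝔼 y, 𝔼 y', 𝔼 ω, 𝔼 u, F ω (merge U y u) * F ω (merge U y' u) := by
  calc (𝔼 ω, 𝔼 x, F ω x) ^ 2
      = (𝔼 ω, 𝔼 u, 𝔼 y, F ω (merge U y u)) ^ 2 := by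
        congr 1
        refine Finset.expect_congr rfl fun ω _ => ?_
        rw [Finset.expect_comm, expect_merge]
    _ ≤ 𝔼 ω, 𝔼 u, (𝔼 y, F ω (merge U y u)) ^ 2 :=
        (sq_expect_le_expect_sq _).trans
          (Finset.expect_le_expect fun ω _ => sq_expect_le_expect_sq _)
    _ = 𝔼 ω, 𝔼 u, 𝔼 y, 𝔼 y', F ω (merge U y u) * F ω (merge U y' u) := by
        simp only [sq, Finset.expect_mul_expect]
    _ = 𝔼 ω, 𝔼 y, 𝔼 y', 𝔼 u, F ω (merge U y u) * F ω (merge U y' u) := by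
        refine Finset.expect_congr rfl fun ω _ => ?_
        rw [Finset.expect_comm]
        exact Finset.expect_congr rfl fun y _ => Finset.expect_comm _ _ _
    _ = 𝔼 y, 𝔼 y', 𝔼 ω, 𝔼 u, F ω (merge U y u) * F ω (merge U y' u) := by
        rw [Finset.expect_comm]
        exact Finset.expect_congr rfl fun y _ => Finset.expect_comm _ _ _

lemma unifProb_eqOn [Fintype ι] [DecidableEq ι] (T : Finset ι) (y : ι → Bool) :
    unifProb (fun y' : ι → Bool => ∀ i ∈ T, y i = y' i) = (1 / 2 : ℝ) ^ T.card := by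
  have h := expect_pi_prod (R := ℝ) T (fun i b => if y i = b then 1 else 0)
  rw [unifProb_def]
  calc _ = 𝔼 y' : ι → Bool, ∏ i ∈ T, (if y i = y' i then (1 : ℝ) else 0) := by
        refine Finset.expect_congr rfl fun y' _ => ?_
        rw [Finset.prod_boole]
        congr!
    _ = _ := by
        rw [h, ← Finset.prod_const]
        refine Finset.prod_congr rfl fun i _ => ?_
        rw [Fintype.expect_eq_sum_div_card]
        simp

end Merge

section Quadratic

variable {p : ℕ} [Fact p.Prime] {m : ℕ}

lemma signMod_injective (hp : p ≠ 2) : Function.Injective (signMod p) := by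
  have h2 := two_ne_zero_of_odd hp
  have h1 : (1 : ZMod p) ≠ -1 := fun h => h2 (by linear_combination h)
  intro a b h
  cases a <;> cases b <;> simp_all [signMod]

lemma expect_singularBordering_mul_le (hp : p ≠ 2) (U : Finset (Fin m)) {β : ℝ} (hβ0 : 0 ≤ β)
    (d : ZMod p) (y y' : Fin m → Bool) (g : Fin m → Fin m → Bool) :
    𝔼 u, (if SingularBordering p d g (merge U y u) then (1 : ℝ) else 0) *
        (if SingularBordering p d g (merge U y' u) then (1 : ℝ) else 0) ≤
      (if ∀ i ∈ Uᶜ, y i = y' i then (1 : ℝ) else 0) +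
      (if HasStructuredSolution p U β
        (fun i => if i ∈ U then 0 else signMod p (y i) - signMod p (y' i)) g then (1 : ℝ) else 0) +
      β := by
  set z : Fin m → ZMod p := fun i => if i ∈ U then 0 else signMod p (y i) - signMod p (y' i)
    with hz
  have hle1 : 𝔼 u, (if SingularBordering p d g (merge U y u) then (1 : ℝ) else 0) *
      (if SingularBordering p d g (merge U y' u) then (1 : ℝ) else 0) ≤ 1 :=
    Finset.expect_le Finset.univ_nonempty fun _ _ => by split_ifs <;> norm_num
  by_cases h1 : ∀ i ∈ Uᶜ, y i = y' i
  · rw [if_pos h1]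
    have : (0 : ℝ) ≤ if HasStructuredSolution p U β z g then (1 : ℝ) else 0 := by
      split_ifs <;> norm_num
    linarith
  by_cases h2 : HasStructuredSolution p U β z g
  · rw [if_pos h2, if_neg h1]
    linarith
  rw [if_neg h1, if_neg h2, zero_add, zero_add]
  by_cases h3 : ∃ u, SingularBordering p d g (merge U y u) ∧ SingularBordering p d g (merge U y' u)
  swap
  · refine (Finset.expect_le Finset.univ_nonempty fun u _ => ?_).trans hβ0
    rw [not_exists] at h3
    have := h3 u
    split_ifs <;> simp_all
  have hsub : ∀ u, signVec p (merge U y u) - signVec p (merge U y' u) = z := by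
    intro u
    funext i
    by_cases hi : i ∈ U <;> simp [signVec, merge, hz, hi]
  obtain ⟨u₀, hu₀, hu₀'⟩ := h3
  obtain ⟨w, hw, -⟩ := hu₀.sub hu₀'
  rw [hsub] at hw
  have hw0 : w ≠ 0 := by
    rintro rfl
    rw [Matrix.mulVec_zero] at hw
    apply h1
    intro i hi
    have h := congrFun hw i
    simp only [hz, Finset.mem_compl.1 hi, if_false, Pi.zero_apply] at h
    exact signMod_injective hp (sub_eq_zero.1 h.symm)
  have hwβ : returnProb w U < β := by
    by_contra hcon
    exact h2 ⟨w, hw0, not_lt.1 hcon, hw⟩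
  set b : ZMod p := -(2⁻¹ * ∑ i ∈ Uᶜ, (signMod p (y i) + signMod p (y' i)) * w i) with hb
  refine le_trans ?_ ((unifProb_sum_signMod_le w U b).trans hwβ.le)
  refine Finset.expect_le_expect fun u _ => ?_
  by_cases h4 : SingularBordering p d g (merge U y u) ∧ SingularBordering p d g (merge U y' u)
  swap
  · rw [not_and] at h4
    split_ifs <;> simp_all
  rw [if_pos h4.1, if_pos h4.2, if_pos, one_mul]
  obtain ⟨w', hw', horth⟩ := h4.1.sub h4.2
  rw [hsub] at hw'
  have hww : w' = w := by
    rw [← sub_eq_zero]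
    apply hu₀.1
    rw [Matrix.mulVec_sub, hw, hw', sub_self]
  rw [hww, dotProduct, ← Finset.sum_add_sum_compl U] at horth
  have e1 : ∑ i ∈ U, (signVec p (merge U y u) + signVec p (merge U y' u)) i * w i =
      2 * ∑ j ∈ U, signMod p (u j) * w j := by
    rw [Finset.mul_sum]
    refine Finset.sum_congr rfl fun i hi => ?_
    simp only [Pi.add_apply, signVec, merge, hi, if_true]
    ring
  have e2 : ∑ i ∈ Uᶜ, (signVec p (merge U y u) + signVec p (merge U y' u)) i * w i =
      ∑ i ∈ Uᶜ, (signMod p (y i) + signMod p (y' i)) * w i := by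
    refine Finset.sum_congr rfl fun i hi => ?_
    simp only [Pi.add_apply, signVec, merge, Finset.mem_compl.1 hi, if_false]
  have h20 := two_ne_zero_of_odd hp
  rw [e1, e2] at horth
  rw [hb]
  field_simp
  linear_combination horth

lemma expect_singularBordering_sq_le (hp : p ≠ 2) (U : Finset (Fin m)) {β q : ℝ} (hβ0 : 0 ≤ β)
    (hq : ∀ z, unifProb (HasStructuredSolution p U β z) ≤ q) (d : ZMod p) :
    (𝔼 g, unifProb (SingularBordering (m := m) p d g)) ^ 2 ≤
      (1 / 2 : ℝ) ^ Uᶜ.card + q + β := by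
  have hcs := sq_expect_expect_le U
    (fun g x => if SingularBordering p d g x then (1 : ℝ) else 0)
  refine hcs.trans ?_
  have key : ∀ y y' : Fin m → Bool, 𝔼 g, 𝔼 u,
      (if SingularBordering p d g (merge U y u) then (1 : ℝ) else 0) *
        (if SingularBordering p d g (merge U y' u) then (1 : ℝ) else 0) ≤
      (if ∀ i ∈ Uᶜ, y i = y' i then (1 : ℝ) else 0) + (q + β) := by
    intro y y'
    refine (Finset.expect_le_expect fun g _ =>
      expect_singularBordering_mul_le hp U hβ0 d y y' g).trans ?_
    have hqz := hq (fun i => if i ∈ U then 0 else signMod p (y i) - signMod p (y' i))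
    rw [unifProb] at hqz
    rw [Finset.expect_add_distrib, Finset.expect_add_distrib, Fintype.expect_const,
      Fintype.expect_const, add_assoc]
    exact add_le_add le_rfl (add_le_add hqz le_rfl)
  refine (Finset.expect_le_expect fun y _ => Finset.expect_le_expect fun y' _ => key y y').trans ?_
  simp only [Finset.expect_add_distrib, Fintype.expect_const]
  rw [add_assoc]
  gcongr
  refine Finset.expect_le Finset.univ_nonempty fun y _ => ?_
  refine le_of_eq ?_
  rw [← unifProb_eqOn Uᶜ y, unifProb_def]

end Quadratic

section Chain

variable {p : ℕ} [Fact p.Prime]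

lemma mulVec_eq_zero_of_corank_eq_zero {n : ℕ} {A : Matrix (Fin n) (Fin n) (ZMod p)}
    (h : corank A = 0) (v : Fin n → ZMod p) (hv : A.mulVec v = 0) : v = 0 := by
  by_contra hv0
  exact (corank_pos_of_det_eq_zero (Matrix.exists_mulVec_eq_zero_iff.1 ⟨v, hv0, hv⟩)).ne' h

lemma expect_kernel_orthogonal_le {m : ℕ} (U : Finset (Fin m)) {β : ℝ} (hβ0 : 0 ≤ β)
    (g : Fin m → Fin m → Bool) (v : Fin m → ZMod p) :
    unifProb (fun x : Fin m → Bool => ¬ HasStructuredSolution p U β 0 g ∧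
      v ≠ 0 ∧ (symMod p m g).mulVec v = 0 ∧ dotProduct (signVec p x) v = 0) ≤ β := by
  by_cases h : ¬ HasStructuredSolution p U β 0 g ∧ v ≠ 0 ∧ (symMod p m g).mulVec v = 0
  · have hvβ : returnProb v U < β := by
      by_contra hcon
      exact h.1 ⟨v, h.2.1, not_lt.1 hcon, h.2.2⟩
    refine (unifProb_mono fun x hx => ?_).trans
      ((unifProb_sum_signMod_le v Finset.univ 0).trans
        ((returnProb_anti v (Finset.subset_univ U)).trans hvβ.le))
    exact hx.2.2.2
  · refine (Finset.expect_le Finset.univ_nonempty fun x _ => ?_).trans hβ0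
    rw [if_neg fun hx => h ⟨hx.1, hx.2.1, hx.2.2.1⟩]

/-- The truth value of a proposition, as a real number. -/
def truthValue (P : Prop) : ℝ := if P then 1 else 0

lemma truthValue_of_true {P : Prop} (h : P) : truthValue P = 1 := if_pos h

lemma truthValue_of_false {P : Prop} (h : ¬ P) : truthValue P = 0 := if_neg h

lemma truthValue_nonneg (P : Prop) : 0 ≤ truthValue P := by
  unfold truthValue
  split_ifs <;> norm_num

lemma unifProb_eq_expect {Ω : Type*} [Fintype Ω] (P : Ω → Prop) :
    unifProb P = 𝔼 ω, truthValue (P ω) := rfl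

lemma unifProb_le_corank_succ (hp : p ≠ 2) {m : ℕ} (U : Finset (Fin m)) {β q : ℝ} (hβ0 : 0 ≤ β)
    (hq : ∀ z, unifProb (HasStructuredSolution p U β z) ≤ q) {k : ℕ} (hk : 1 ≤ k) :
    unifProb (fun g => k ≤ corank (symMod p (m + 1) g)) ≤
      unifProb (fun g => k + 1 ≤ corank (symMod p m g)) +
        (q + β + √((1 / 2 : ℝ) ^ Uᶜ.card + q + β)) := by
  have hv : ∀ g : Fin m → Fin m → Bool, ∃ v : Fin m → ZMod p,
      0 < corank (symMod p m g) → v ≠ 0 ∧ (symMod p m g).mulVec v = 0 := by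
    intro g
    by_cases h : 0 < corank (symMod p m g)
    · obtain ⟨v, hv0, hv⟩ := exists_mulVec_eq_zero_of_corank_pos h
      exact ⟨v, fun _ => ⟨hv0, hv⟩⟩
    · exact ⟨0, fun h' => absurd h' h⟩
  choose v hv using hv
  set A : (Fin m → Fin m → Bool) → Prop := fun g => k + 1 ≤ corank (symMod p m g) with hA
  set B : (Fin m → Fin m → Bool) → Prop := HasStructuredSolution p U β 0 with hB
  set D : (Fin m → Fin m → Bool) → (Fin m → Bool) → Prop := fun g x => ¬ B g ∧ v g ≠ 0 ∧
    (symMod p m g).mulVec (v g) = 0 ∧ dotProduct (signVec p x) (v g) = 0 with hD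
  have hpt : ∀ e g x, truthValue (k ≤ corank (symMod p (m + 1) (bordered e g x))) ≤
      truthValue (A g) + truthValue (B g) +
        truthValue (D g x) +
        truthValue (SingularBordering p (signMod p e.2) g x) := by
    intro e g x
    have hA0 := truthValue_nonneg (A g)
    have hB0 := truthValue_nonneg (B g)
    have hD0 := truthValue_nonneg (D g x)
    have hS0 := truthValue_nonneg (SingularBordering p (signMod p e.2) g x)
    by_cases h : k ≤ corank (symMod p (m + 1) (bordered e g x))
    swap
    · rw [truthValue_of_false h]; linarith
    rw [truthValue_of_true h]
    rcases Nat.eq_zero_or_pos (corank (symMod p m g)) with hc | hc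
    · rw [truthValue_of_true (singularBordering_of_corank_pos e g x
        (mulVec_eq_zero_of_corank_eq_zero hc) (hk.trans h))]
      linarith
    by_cases h1 : B g
    · rw [truthValue_of_true h1]; linarith
    obtain ⟨hv0, hvk⟩ := hv g hc
    by_cases h2 : dotProduct (signVec p x) (v g) = 0
    · rw [truthValue_of_true (show D g x from ⟨h1, hv0, hvk, h2⟩)]; linarith
    · have h3 := corank_bordered_lt e g x hvk h2
      rw [truthValue_of_true (show A g from by simp only [hA]; omega)]
      linarith
  calc unifProb (fun g => k ≤ corank (symMod p (m + 1) g))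
      = 𝔼 e, 𝔼 g, 𝔼 x,
          truthValue (k ≤ corank (symMod p (m + 1) (bordered e g x))) := by
        rw [unifProb_eq_expect, Fintype.expect_equiv (borderEquiv m) _ (fun q =>
          truthValue (k ≤ corank (symMod p (m + 1) (bordered q.1 q.2.1 q.2.2))))
          (fun G => by simp [bordered]), ← Finset.univ_product_univ,
          Finset.expect_product]
        refine Finset.expect_congr rfl fun e _ => ?_
        rw [← Finset.univ_product_univ, Finset.expect_product]
    _ ≤ 𝔼 e : (Fin m → Bool) × Bool, 𝔼 g, 𝔼 x, (truthValue (A g) +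
          truthValue (B g) + truthValue (D g x) +
          truthValue (SingularBordering p (signMod p e.2) g x)) :=
        Finset.expect_le_expect fun e _ => Finset.expect_le_expect fun g _ =>
          Finset.expect_le_expect fun x _ => hpt e g x
    _ = 𝔼 e : (Fin m → Bool) × Bool, (unifProb A + unifProb B + 𝔼 g, unifProb (D g) +
          𝔼 g, unifProb (SingularBordering (m := m) p (signMod p e.2) g)) := by
        simp only [Finset.expect_add_distrib, Fintype.expect_const, unifProb_eq_expect]
    _ ≤ 𝔼 e : (Fin m → Bool) × Bool,
          (unifProb A + q + β + √((1 / 2 : ℝ) ^ Uᶜ.card + q + β)) := by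
        refine Finset.expect_le_expect fun e _ => ?_
        have h1 := hq 0
        have h2 : 𝔼 g, unifProb (D g) ≤ β :=
          Finset.expect_le Finset.univ_nonempty fun g _ => expect_kernel_orthogonal_le U hβ0 g (v g)
        have h3 := Real.le_sqrt_of_sq_le
          (expect_singularBordering_sq_le hp U hβ0 hq (signMod p e.2))
        linarith
    _ = _ := by rw [Fintype.expect_const]; ring

lemma unifProb_corank_pos_le {n : ℕ} {ε : ℝ} (hε : 0 ≤ ε)
    (hstep : ∀ m, n / 2 ≤ m → m < n → ∀ k, 1 ≤ k →
      unifProb (fun g => k ≤ corank (symMod p (m + 1) g)) ≤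
        unifProb (fun g => k + 1 ≤ corank (symMod p m g)) + ε) :
    unifProb (fun g => 1 ≤ corank (symMod p n g)) ≤ n * ε := by
  have hchain : ∀ j, ∀ k, 1 ≤ k → n / 2 + j ≤ n →
      unifProb (fun g => k ≤ corank (symMod p (n / 2 + j) g)) ≤
        unifProb (fun g => k + j ≤ corank (symMod p (n / 2) g)) + j * ε := by
    intro j
    induction j with
    | zero => intro k _ _; simp
    | succ j ih =>
      intro k hk hj
      have h1 := hstep (n / 2 + j) (by omega) (by omega) k hk
      have h2 := ih (k + 1) (by omega) (by omega)
      rw [show k + 1 + j = k + (j + 1) by ring] at h2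
      push_cast
      rw [← add_assoc]
      linarith
  have h := hchain (n - n / 2) 1 le_rfl (by omega)
  rw [show n / 2 + (n - n / 2) = n by omega] at h
  have h0 : unifProb (fun g => 1 + (n - n / 2) ≤ corank (symMod p (n / 2) g)) ≤ 0 := by
    refine Finset.expect_le Finset.univ_nonempty fun g _ => ?_
    rw [if_neg]
    have := corank_le (symMod p (n / 2) g)
    omega
  have h1 : ((n - n / 2 : ℕ) : ℝ) * ε ≤ n * ε := by
    gcongr
    omega
  linarith

lemma det_symMod_eq_zero {n : ℕ} {g : Fin n → Fin n → Bool} (h : (symMat n g).det = 0) :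
    (symMod p n g).det = 0 := by
  set A : Matrix (Fin n) (Fin n) ℤ := Matrix.of fun i j => if symBit g i j then 1 else -1 with hA
  have h1 : symMat n g = (Int.castRingHom ℝ).mapMatrix A := by
    ext i j
    simp only [symMat, hA, symBit, signv, RingHom.mapMatrix_apply, Matrix.map_apply,
      Matrix.of_apply]
    split_ifs <;> simp
  have h2 : symMod p n g = (Int.castRingHom (ZMod p)).mapMatrix A := by
    ext i j
    simp only [symMod, hA, signMod, RingHom.mapMatrix_apply, Matrix.map_apply, Matrix.of_apply]
    split_ifs <;> simp
  rw [h1, ← RingHom.map_det] at h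
  have h3 : A.det = 0 := by simpa using h
  rw [h2, ← RingHom.map_det, h3, map_zero]

variable (p) in
lemma probSym_det_eq_zero_le (n : ℕ) :
    probSym n (fun M => M.det = 0) ≤ unifProb (fun g => 1 ≤ corank (symMod p n g)) := by
  have h : probSym n (fun M => M.det = 0) = unifProb (fun g => (symMat n g).det = 0) := by
    rw [probSym, unifProb, Fintype.expect_eq_sum_div_card, Finset.sum_boole]
  rw [h]
  exact unifProb_mono fun g hg => corank_pos_of_det_eq_zero (det_symMod_eq_zero hg)

end Chain

/-! ### Choice of parameters -/

lemma exists_mul_sq_log_le (A : ℕ) :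
    ∃ N, ∀ n, N ≤ n → A * (Nat.log 2 n + 1) ^ 2 ≤ n / 2 := by
  have h1 := tendsto_pow_const_div_const_pow_of_one_lt 2 (one_lt_two (α := ℝ))
  have h2 : (0 : ℝ) < 1 / (8 * (A + 1)) := by positivity
  obtain ⟨L₀, hL₀⟩ := Filter.eventually_atTop.1 (h1.eventually_le_const h2)
  refine ⟨2 ^ L₀, fun n hn => ?_⟩
  have hn0 : n ≠ 0 := by
    have := Nat.one_le_two_pow (n := L₀)
    omega
  set L := Nat.log 2 n + 1 with hL
  have hLL₀ : L₀ ≤ L := (Nat.le_log_of_pow_le one_lt_two hn).trans (Nat.le_succ _)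
  have h3 := hL₀ L hLL₀
  rw [div_le_div_iff₀ (by positivity) (by positivity)] at h3
  have h4 : L ^ 2 * (8 * (A + 1)) ≤ 1 * 2 ^ L := by exact_mod_cast h3
  have h5 : 2 ^ L ≤ 2 * n := by
    have := Nat.pow_log_le_self 2 hn0
    rw [hL, pow_succ]
    omega
  have h6 : 8 * (A * L ^ 2) ≤ 2 * n := by nlinarith
  have h7 : L ^ 2 * (8 * (A + 1)) = 8 * (A * L ^ 2) + 8 * L ^ 2 := by ring
  have h8 : 1 ≤ L ^ 2 := Nat.one_le_pow _ _ (by omega)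
  omega

lemma exists_finset_card_compl {m u : ℕ} (h : u ≤ m) : ∃ U : Finset (Fin m), Uᶜ.card = u := by
  obtain ⟨V, -, hV⟩ := Finset.exists_subset_card_eq (s := (Finset.univ : Finset (Fin m)))
    (n := u) (by simpa using h)
  exact ⟨Vᶜ, by rw [compl_compl, hV]⟩

/-- The polynomially many sets of structured vectors cost less than the exponentially small
probability attached to each one. -/
lemma pow_mul_pow_le {p m a b s t : ℕ} (hp : p ≤ 2 ^ a) (hm : t + 14 * (a * b + s) ≤ m) :
    (p : ℝ) ^ b * (19 / 20 : ℝ) ^ (m - t) ≤ (1 / 2 : ℝ) ^ s := by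
  have h1 : (p : ℝ) ≤ 2 ^ a := by exact_mod_cast hp
  have h2 : (19 / 20 : ℝ) ^ (m - t) ≤ (1 / 2) ^ (a * b + s) := by
    calc (19 / 20 : ℝ) ^ (m - t) ≤ (19 / 20 : ℝ) ^ (14 * (a * b + s)) :=
          pow_le_pow_of_le_one (by norm_num) (by norm_num) (by omega)
      _ = ((19 / 20 : ℝ) ^ 14) ^ (a * b + s) := pow_mul _ _ _
      _ ≤ (1 / 2) ^ (a * b + s) := by
          gcongr
          norm_num
  calc (p : ℝ) ^ b * (19 / 20 : ℝ) ^ (m - t) ≤ (2 ^ a) ^ b * (1 / 2) ^ (a * b + s) := by gcongr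
    _ = (1 / 2 : ℝ) ^ s := by
        rw [pow_add, ← pow_mul, ← mul_assoc, ← mul_pow]
        norm_num

lemma probSym_det_eq_zero_le_of_large (E : ℕ) :
    ∃ N, ∀ n, N ≤ n → probSym n (fun M => M.det = 0) ≤ 4 * ((n : ℝ) ^ E)⁻¹ := by
  set D := 2 * (E + 1) with hD
  obtain ⟨N, hN⟩ := exists_mul_sq_log_le (10000 * (D + 3) ^ 2)
  refine ⟨max N 3, fun n hn => ?_⟩
  have hn3 : 3 ≤ n := (le_max_right _ _).trans hn
  have hlarge := hN n ((le_max_left _ _).trans hn)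
  set L := Nat.log 2 n + 1 with hL
  have hnL : n ≤ 2 ^ L := (Nat.lt_pow_succ_log_self one_lt_two n).le
  obtain ⟨p, hpp, hp1, hp2⟩ :=
    Nat.exists_prime_lt_and_le_two_mul (n ^ (D + 2)) (by positivity)
  have : Fact p.Prime := ⟨hpp⟩
  have hnp : n ^ 2 * n ^ D < p := by rwa [← pow_add, add_comm]
  have hnD : 1 ≤ n ^ D := Nat.one_le_pow _ _ (by omega)
  have hn2p : n ^ 2 < p := by nlinarith
  have hnp' : n < p := by nlinarith
  have hpne : p ≠ 2 := by omega
  have hpL : p ≤ 2 ^ (L * (D + 2) + 1) := by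
    calc p ≤ 2 * n ^ (D + 2) := hp2
      _ ≤ 2 * (2 ^ L) ^ (D + 2) := by gcongr
      _ = 2 ^ (L * (D + 2) + 1) := by rw [← pow_mul, pow_succ, mul_comm]
  set r : ℝ := ((n : ℝ) ^ (E + 1))⁻¹ with hr
  have hn1 : (1 : ℝ) ≤ n := by exact_mod_cast (by omega : 1 ≤ n)
  have hr0 : 0 ≤ r := by positivity
  have hr1 : r ≤ 1 := inv_le_one_of_one_le₀ (one_le_pow₀ hn1)
  set β : ℝ := r ^ 2 with hβ
  have hβ0 : 0 ≤ β := by positivity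
  have hβD : β = ((n : ℝ) ^ D)⁻¹ := by
    rw [hβ, hr, inv_pow, ← pow_mul, hD, mul_comm]
  have hhalf : (1 / 2 : ℝ) ^ (D * L) ≤ β := by
    rw [hβD, one_div, inv_pow, mul_comm, pow_mul]
    gcongr
    exact_mod_cast hnL
  have hβpos : 0 < β := lt_of_lt_of_le (by positivity) hhalf
  have hpβ : 4 < p * β := by
    rw [hβD, ← div_eq_mul_inv, lt_div_iff₀ (by positivity)]
    have : 4 * n ^ D < p := lt_of_le_of_lt (Nat.mul_le_mul_right _ (by nlinarith)) hnp
    exact_mod_cast this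
  obtain ⟨u, hu⟩ : ∃ u, u = D * L := ⟨_, rfl⟩
  obtain ⟨τ, hτ⟩ : ∃ τ, τ = 112 * (u + 2) := ⟨_, rfl⟩
  rw [← hu] at hhalf
  have hτβ : (159 / 160 : ℝ) ^ τ < β / 2 := by
    calc (159 / 160 : ℝ) ^ τ = ((159 / 160 : ℝ) ^ 112) ^ (u + 2) := by rw [hτ, pow_mul]
      _ ≤ (1 / 2) ^ (u + 2) := by
          gcongr
          norm_num
      _ = (1 / 2) ^ u / 4 := by ring
      _ ≤ β / 4 := by gcongr
      _ < β / 2 := by linarith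
  have hbig : τ + u + 14 * ((L * (D + 2) + 1) * (2 * τ + u) + u) ≤ n / 2 := by
    refine le_trans ?_ hlarge
    have hL1 : 1 ≤ L := by omega
    obtain ⟨a, ha⟩ : ∃ a, a = (D + 3) * L := ⟨_, rfl⟩
    have h1 : u + 3 ≤ a := by
      rw [hu, ha]; nlinarith
    have h2 : L * (D + 2) + 1 ≤ a := by
      rw [ha]; nlinarith
    have h3 : τ ≤ 112 * a := by omega
    have h4 : a ≤ a ^ 2 := Nat.le_self_pow two_ne_zero a
    calc τ + u + 14 * ((L * (D + 2) + 1) * (2 * τ + u) + u)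
        ≤ 112 * a + a + 14 * (a * (2 * (112 * a) + a) + a) := by gcongr <;> omega
      _ = 127 * a + 3150 * a ^ 2 := by ring
      _ ≤ 10000 * a ^ 2 := by linarith
      _ = 10000 * (D + 3) ^ 2 * L ^ 2 := by rw [ha]; ring
  have hstep : ∀ m, n / 2 ≤ m → m < n → ∀ k, 1 ≤ k →
      unifProb (fun g => k ≤ corank (symMod p (m + 1) g)) ≤
        unifProb (fun g => k + 1 ≤ corank (symMod p m g)) + 4 * r := by
    intro m hm hmn k hk
    obtain ⟨U, hU⟩ := exists_finset_card_compl (m := m) (u := u) (by omega)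
    have hq : ∀ z, unifProb (HasStructuredSolution p U β z) ≤ β := by
      intro z
      refine (unifProb_hasStructuredSolution_le hpne (by omega) U hpβ hτβ z).trans ?_
      rw [hU, Nat.sub_sub]
      exact (pow_mul_pow_le hpL (hbig.trans hm)).trans hhalf
    refine (unifProb_le_corank_succ hpne U hβ0 hq hk).trans ?_
    rw [hU]
    have h1 : √((1 / 2 : ℝ) ^ u + β + β) ≤ 2 * r := by
      rw [Real.sqrt_le_left (by positivity), mul_pow, ← hβ]
      linarith
    have h2 : β ≤ r := by
      rw [hβ]; nlinarith
    linarith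
  calc probSym n (fun M => M.det = 0)
      ≤ unifProb (fun g => 1 ≤ corank (symMod p n g)) := probSym_det_eq_zero_le p n
    _ ≤ n * (4 * r) := unifProb_corank_pos_le (by positivity) hstep
    _ = 4 * ((n : ℝ) ^ E)⁻¹ := by
        rw [hr, pow_succ]
        field_simp

lemma probSym_le_one (n : ℕ) (P : Matrix (Fin n) (Fin n) ℝ → Prop) : probSym n P ≤ 1 :=
  div_le_one_of_le₀ (by exact_mod_cast Finset.card_le_univ _) (by positivity)

/-- For every constant `C > 0` there is `K = K(C) > 0` such that for all `n ≥ 1`,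
`P(det M_n = 0) ≤ K · n^{-C}`. -/
theorem singularity_prob_poly_decay :
    ∀ C : ℝ, 0 < C → ∃ K : ℝ, 0 < K ∧ ∀ n : ℕ, 1 ≤ n →
      probSym n (fun M => M.det = 0) ≤ K * (n : ℝ) ^ (-C) := by
  intro C hC
  obtain ⟨E, hE⟩ := exists_nat_ge C
  obtain ⟨N, hN⟩ := probSym_det_eq_zero_le_of_large E
  refine ⟨4 + (N : ℝ) ^ C, by positivity, fun n hn => ?_⟩
  have hn1 : (1 : ℝ) ≤ n := by exact_mod_cast hn
  have hn0 : (0 : ℝ) < n := by linarith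
  have hnC : 0 < (n : ℝ) ^ (-C) := Real.rpow_pos_of_pos hn0 _
  have hNC : 0 ≤ (N : ℝ) ^ C := by positivity
  rcases le_total N n with h | h
  · refine (hN n h).trans ?_
    have h1 : ((n : ℝ) ^ E)⁻¹ ≤ (n : ℝ) ^ (-C) := by
      rw [← Real.rpow_natCast, ← Real.rpow_neg hn0.le]
      exact Real.rpow_le_rpow_of_exponent_le hn1 (by linarith)
    nlinarith
  · refine (probSym_le_one n _).trans ?_
    have h1 : (n : ℝ) ^ C ≤ (N : ℝ) ^ C := by gcongr
    have h2 : (n : ℝ) ^ C * (n : ℝ) ^ (-C) = 1 := by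
      rw [← Real.rpow_add hn0, add_neg_cancel, Real.rpow_zero]
    nlinarith

end
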